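/- arXiv:1305.6402 — 2 statements merged into one kernel-verified Lean document; each statement's English description precedes it below -/
import Mathlib

section
/- Let A be a real n×n matrix, B a real n×m matrix, and C_v a real q×n matrix. Define the PID-augmented matrices A_m = [[A,0,0],[C_v, I_q, 0],[C_v(A − I_n), 0, 0]] (size (n+2q)×(n+2q)) and B_m = [[B],[0],[C_v B]] (size (n+2q)×m). Assume (A,B) is Hautus-controllable (rank [λI_n − A, B] = n for all λ ∈ ℂ) and rank [[A − I_n, B],[C_v, 0]] = n+q. Then for every complex λ with |λ| ≥ 1, rank [λI_{n+2q} − A_m, B_m] = n+2q; i.e. the PID-augmented system is stabilizable in the Hautus sense. -/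
open Matrix

lemma rank_full_iff {K ι κ : Type*} [Field K] [Fintype ι] [Fintype κ] (M : Matrix ι κ K) :
    M.rank = Fintype.card ι ↔ ∀ v : ι → K, v ᵥ* M = 0 → v = 0 := by
  classical
  rw [Matrix.rank_eq_finrank_span_row, eq_comm]
  have h := linearIndependent_iff_card_eq_finrank_span (R := K) (b := M.row)
  rw [Set.finrank] at h
  rw [← h, ← Matrix.vecMul_injective_iff]
  exact injective_iff_map_eq_zero (Matrix.vecMulLinear M)

lemma complex_of_real_inj {ι κ : Type*} [Fintype ι] (M : Matrix ι κ ℝ)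
    (h : ∀ v : ι → ℝ, v ᵥ* M = 0 → v = 0) (v : ι → ℂ)
    (hv : v ᵥ* M.map Complex.ofReal = 0) : v = 0 := by
  have h1 := h (fun i => (v i).re) (by
    ext j
    have := congrArg Complex.re (congrFun hv j)
    simpa [Matrix.vecMul, dotProduct] using this)
  have h2 := h (fun i => (v i).im) (by
    ext j
    have := congrArg Complex.im (congrFun hv j)
    simpa [Matrix.vecMul, dotProduct] using this)
  ext i
  exact Complex.ext (congrFun h1 i) (congrFun h2 i)

/-- If `(A,B)` is Hautus-controllable and
`rank [[A − I, B],[C_v, 0]] = n + q`, then the PID-augmented pair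
`A_m = [[A,0,0],[C_v,I_q,0],[C_v(A−I),0,0]]`, `B_m = [[B],[0],[C_v B]]`
is Hautus-stabilizable: its Hautus matrix has full rank for all `|λ| ≥ 1`. -/
theorem pid_augmented_hautus_stabilizable (n m q : ℕ)
    (A : Matrix (Fin n) (Fin n) ℝ) (B : Matrix (Fin n) (Fin m) ℝ)
    (Cv : Matrix (Fin q) (Fin n) ℝ)
    (hctrl : ∀ lam : ℂ,
      (Matrix.fromCols
          (lam • (1 : Matrix (Fin n) (Fin n) ℂ) - A.map Complex.ofReal)
          (B.map Complex.ofReal)).rank = n)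
    (hrank : (Matrix.fromBlocks (A - 1) B Cv (0 : Matrix (Fin q) (Fin m) ℝ)).rank
      = n + q) :
    ∀ lam : ℂ, 1 ≤ ‖lam‖ →
      (Matrix.fromCols
          (lam • (1 : Matrix (Fin n ⊕ (Fin q ⊕ Fin q)) (Fin n ⊕ (Fin q ⊕ Fin q)) ℂ) -
            (Matrix.fromBlocks A 0
              (Matrix.fromRows Cv (Cv * (A - 1)))
              (Matrix.fromBlocks (1 : Matrix (Fin q) (Fin q) ℝ) 0 0
                (0 : Matrix (Fin q) (Fin q) ℝ))).map Complex.ofReal)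
          ((Matrix.fromRows B
            (Matrix.fromRows (0 : Matrix (Fin q) (Fin m) ℝ) (Cv * B))).map
              Complex.ofReal)).rank = n + 2 * q := by
  intro lam hl
  have key := (rank_full_iff _).1 (show _ = Fintype.card (Fin n ⊕ Fin q) by simpa using hrank)
  have keyC := complex_of_real_inj _ key
  have hc := fun l => (rank_full_iff _).1 (show _ = Fintype.card (Fin n) by simpa using hctrl l)
  have hl0 : lam ≠ 0 := by
    rintro rfl
    norm_num at hl
  rw [show n + 2 * q = Fintype.card (Fin n ⊕ (Fin q ⊕ Fin q)) by simp; ring, rank_full_iff]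
  intro v hv
  obtain ⟨x, w, rfl⟩ : ∃ x w, v = Sum.elim x w := ⟨_, _, (Sum.elim_comp_inl_inr v).symm⟩
  obtain ⟨y, z, rfl⟩ : ∃ y z, w = Sum.elim y z := ⟨_, _, (Sum.elim_comp_inl_inr w).symm⟩
  have e1 : ∀ j, lam * x j - (x ᵥ* A.map Complex.ofReal) j - (y ᵥ* Cv.map Complex.ofReal) j
      - (z ᵥ* (Cv * (A - 1)).map Complex.ofReal) j = 0 := by
    intro j
    have := congrFun hv (Sum.inl (Sum.inl j))
    simp [Matrix.vecMul_sub, Matrix.vecMul_smul, Matrix.fromBlocks_map, Matrix.fromRows_map,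
      Matrix.vecMul_fromBlocks, Matrix.vecMul_fromCols, -Matrix.map_mul] at this
    linear_combination this
  have e2 : ∀ j, lam * y j - y j = 0 := by
    intro j
    have := congrFun hv (Sum.inl (Sum.inr (Sum.inl j)))
    simpa [Matrix.vecMul_sub, Matrix.vecMul_smul, Matrix.fromBlocks_map, Matrix.fromRows_map,
      Matrix.vecMul_fromBlocks, Matrix.vecMul_fromCols] using this
  have e3 : ∀ j, lam * z j = 0 := by
    intro j
    have := congrFun hv (Sum.inl (Sum.inr (Sum.inr j)))
    simpa [Matrix.vecMul_sub, Matrix.vecMul_smul, Matrix.fromBlocks_map, Matrix.fromRows_map,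
      Matrix.vecMul_fromBlocks, Matrix.vecMul_fromCols] using this
  have e4 : x ᵥ* B.map Complex.ofReal + z ᵥ* (Cv * B).map Complex.ofReal = 0 := by
    ext j
    have := congrFun hv (Sum.inr j)
    simpa [Matrix.fromRows_map, Matrix.vecMul_fromCols, -Matrix.map_mul] using this
  have hz : z = 0 := by
    ext j
    simpa [hl0] using e3 j
  subst hz
  simp only [Matrix.zero_vecMul, add_zero, Pi.zero_apply, sub_zero] at e1 e4
  by_cases h1 : lam = 1
  · subst h1
    have hxy := keyC (Sum.elim x y) (by
      ext j
      rcases j with j | j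
      · have := e1 j
        simp [Matrix.fromBlocks_map, Matrix.vecMul_fromBlocks, Matrix.vecMul_sub, Matrix.map_sub]
        linear_combination -this
      · simpa [Matrix.fromBlocks_map, Matrix.vecMul_fromBlocks] using congrFun e4 j)
    ext j
    rcases j with j | j | j
    · simpa using congrFun hxy (Sum.inl j)
    · simpa using congrFun hxy (Sum.inr j)
    · simp
  · have hy : y = 0 := by
      ext j
      have : (lam - 1) * y j = 0 := by linear_combination e2 j
      simpa [sub_ne_zero.2 h1] using this
    subst hy
    have hx : x = 0 := hc lam x (by
      ext j
      rcases j with j | j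
      · have := e1 j
        simpa [Matrix.vecMul_sub, Matrix.vecMul_smul, Matrix.vecMul_fromCols] using this
      · simpa [Matrix.vecMul_fromCols] using congrFun e4 j)
    subst hx
    simp
end

section
/- Let A be a real n×n matrix, C a real p×n matrix, and C_v a real q×n matrix. Define A_m = [[A,0,0],[C_v, I_q, 0],[C_v(A − I_n), 0, 0]] and the output matrix C_m = [C, 0, 0] (size p×(n+2q)). Assume (A,C) is Hautus-observable (rank [λI_n − A; C] = n for all λ ∈ ℂ). Then for every complex λ with λ ≠ 0 and λ ≠ 1, the stacked matrix [λI_{n+2q} − A_m; C_m] has rank n+2q. -/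
open Matrix

lemma rank_eq_card_iff_ker {m n : Type*} [Fintype m] [Fintype n] [DecidableEq n]
    (M : Matrix m n ℂ) :
    M.rank = Fintype.card n ↔ ∀ v, M *ᵥ v = 0 → v = 0 := by
  have h := M.mulVecLin.finrank_range_add_finrank_ker
  rw [Module.finrank_fintype_fun_eq_card] at h
  have h2 : M.rank = Module.finrank ℂ (LinearMap.range M.mulVecLin) := rfl
  rw [← h2] at h
  have h3 : (∀ v, M *ᵥ v = 0 → v = 0) ↔ LinearMap.ker M.mulVecLin = ⊥ := by
    rw [LinearMap.ker_eq_bot']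
    rfl
  rw [h3, ← Submodule.finrank_eq_zero]
  omega

/-- If `(A,C)` is Hautus-observable, then for every complex `λ`
with `λ ≠ 0` and `λ ≠ 1`, the stacked Hautus matrix `[λI − A_m; C_m]` of the
PID-augmented pair `A_m = [[A,0,0],[C_v,I_q,0],[C_v(A−I),0,0]]`,
`C_m = [C, 0, 0]` has full rank `n + 2q`. -/
theorem pid_augmented_hautus_observability (n p q : ℕ)
    (A : Matrix (Fin n) (Fin n) ℝ) (C : Matrix (Fin p) (Fin n) ℝ)
    (Cv : Matrix (Fin q) (Fin n) ℝ)
    (hobs : ∀ lam : ℂ,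
      (Matrix.fromRows
          (lam • (1 : Matrix (Fin n) (Fin n) ℂ) - A.map Complex.ofReal)
          (C.map Complex.ofReal)).rank = n)
    (lam : ℂ) (hlam0 : lam ≠ 0) (hlam1 : lam ≠ 1) :
    (Matrix.fromRows
        (lam • (1 : Matrix (Fin n ⊕ (Fin q ⊕ Fin q)) (Fin n ⊕ (Fin q ⊕ Fin q)) ℂ) -
          (Matrix.fromBlocks A 0
            (Matrix.fromRows Cv (Cv * (A - 1)))
            (Matrix.fromBlocks (1 : Matrix (Fin q) (Fin q) ℝ) 0 0
              (0 : Matrix (Fin q) (Fin q) ℝ))).map Complex.ofReal)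
        ((Matrix.fromCols C
          (0 : Matrix (Fin p) (Fin q ⊕ Fin q) ℝ)).map Complex.ofReal)).rank
      = n + 2 * q := by
  have hx := (rank_eq_card_iff_ker _).1 ((hobs lam).trans (Fintype.card_fin n).symm)
  have hc : n + 2 * q = Fintype.card (Fin n ⊕ (Fin q ⊕ Fin q)) := by
    simp [two_mul]
  rw [hc, rank_eq_card_iff_ker]
  intro v hv
  obtain ⟨x, y, z, rfl⟩ : ∃ x y z, v = Sum.elim x (Sum.elim y z) :=
    ⟨fun i => v (.inl i), fun i => v (.inr (.inl i)), fun i => v (.inr (.inr i)), by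
      ext (i | i | i) <;> rfl⟩
  rw [fromRows_mulVec, sub_mulVec, smul_mulVec, one_mulVec, fromBlocks_map, fromBlocks_mulVec,
    fromBlocks_map, fromBlocks_mulVec] at hv
  have h1 : x = 0 := by
    apply hx
    ext (i | i)
    · have := congrFun hv (.inl (.inl i))
      simpa [fromRows_mulVec, sub_mulVec, smul_mulVec] using this
    · have := congrFun hv (.inr i)
      simpa [fromRows_mulVec, mulVec, dotProduct] using this
  subst h1
  ext (i | i | i)
  · rfl
  · have := congrFun hv (.inl (.inr (.inl i)))
    simp at this
    have h4 : (lam - 1) * y i = 0 := by linear_combination this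
    simpa [sub_ne_zero.2 hlam1] using h4
  · have := congrFun hv (.inl (.inr (.inr i)))
    simpa [hlam0] using this
end
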